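/- arXiv:2111.02731 — 2 statements merged into one kernel-verified Lean document; each statement's English description precedes it below -/
import Mathlib

section
/- Let α ∈ (0,1) and t > 0. Then the total variation distance between the law of K(α, t n^α, n) under the NB-CPSM and the law of 1 + P_{t n^α} (P_λ denoting a Poisson random variable with parameter λ) tends to 0 as n → ∞. Explicitly: lim_{n→∞} (1/2) ∑_{k=1}^{∞} | p_n(k) - q_n(k) | = 0, where p_n(k) := 𝒞(n,k;α)(t n^α)^k / ∑_{j=1}^n 𝒞(n,j;α)(t n^α)^j for 1 ≤ k ≤ n and p_n(k) := 0 for k > n, and q_n(k) := e^{-t n^α} (t n^α)^{k-1} / (k-1)! for k ≥ 1. -/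
open Finset Filter Real MeasureTheory Topology Set

/-- Ascending factorial `(x)_{(n)} = x (x+1) ⋯ (x+n-1)`. -/
noncomputable def ascFact (x : ℝ) (n : ℕ) : ℝ := ∏ i ∈ Finset.range n, (x + i)

/-- Falling factorial `(a)_{[n]} = a (a-1) ⋯ (a-n+1)`. -/
noncomputable def fallFact (a : ℝ) (n : ℕ) : ℝ := ∏ i ∈ Finset.range n, (a - i)

/-- Generalized factorial coefficient
`𝒞(n,j;α) = (1/j!) ∑_{i=0}^{j} C(j,i) (-1)^i (-iα)_{(n)}`. -/
noncomputable def genFact (n j : ℕ) (α : ℝ) : ℝ :=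
  (1 / (Nat.factorial j : ℝ)) *
    ∑ i ∈ Finset.range (j + 1), (Nat.choose j i : ℝ) * (-1) ^ i * ascFact (-(i * α)) n

lemma ascFact_succ (x : ℝ) (n : ℕ) : ascFact x (n + 1) = ascFact x n * (x + n) :=
  Finset.prod_range_succ _ _

lemma ascFact_succ_left (x : ℝ) (n : ℕ) : ascFact x (n + 1) = x * ascFact (x + 1) n := by
  unfold ascFact
  rw [Finset.prod_range_succ', mul_comm]
  congr 1
  · simp
  · exact Finset.prod_congr rfl fun i _ => by push_cast; ring

lemma ascFact_pos {x : ℝ} (hx : 0 < x) (n : ℕ) : 0 < ascFact x n :=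
  Finset.prod_pos fun _ _ => by positivity

/-- The power series of `(1 - X) ^ (-x)`. -/
noncomputable def ascSeries (x : ℝ) : PowerSeries ℝ :=
  PowerSeries.mk fun n => ascFact x n / n.factorial

lemma ascSeries_eq_rescale (x : ℝ) :
    ascSeries x = PowerSeries.rescale (-1 : ℝ) (PowerSeries.binomialSeries ℝ (-x)) := by
  ext n
  rw [PowerSeries.coeff_rescale, PowerSeries.binomialSeries_coeff, ascSeries, PowerSeries.coeff_mk,
    Ring.choose_eq_smul]
  have h : (descPochhammer ℤ n).smeval (-x) = (-1) ^ n * ascFact x n := by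
    induction n with
    | zero => simp [ascFact]
    | succ n ih =>
      rw [descPochhammer_succ_right, Polynomial.smeval_mul, ih, ascFact_succ, Polynomial.smeval_sub,
        Polynomial.smeval_X, Polynomial.smeval_natCast]
      simp
      ring
  have h1 : ((-1 : ℝ) ^ n) * (-1) ^ n = 1 := by rw [← mul_pow]; simp
  rw [h, smul_eq_mul, smul_eq_mul, mul_one]
  linear_combination (-(ascFact x n / n.factorial)) * h1

lemma ascSeries_add (x y : ℝ) : ascSeries (x + y) = ascSeries x * ascSeries y := by
  simp only [ascSeries_eq_rescale, neg_add, PowerSeries.binomialSeries_add, map_mul]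

lemma ascSeries_natCast_mul (x : ℝ) (i : ℕ) : ascSeries (i * x) = ascSeries x ^ i := by
  induction i with
  | zero => simp [ascSeries_eq_rescale]
  | succ i ih => rw [pow_succ, ← ih, ← ascSeries_add]; congr 1; push_cast; ring

/-- The power series of `1 - (1 - X) ^ α`, the generating function of the Sibuya law. -/
noncomputable def sibuyaSeries (α : ℝ) : PowerSeries ℝ := 1 - ascSeries (-α)

/-- The probability that a sum of `k` independent Sibuya variables equals `n`. -/
noncomputable def sibuyaSum (α : ℝ) (n k : ℕ) : ℝ := PowerSeries.coeff n (sibuyaSeries α ^ k)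

lemma sibuyaSum_eq_sum (α : ℝ) (n k : ℕ) :
    sibuyaSum α n k = ∑ i ∈ Finset.range (k + 1),
      (k.choose i : ℝ) * (-1) ^ i * (ascFact (-(i * α)) n / n.factorial) := by
  have h : sibuyaSeries α ^ k = ∑ i ∈ Finset.range (k + 1),
      PowerSeries.C ((k.choose i : ℝ) * (-1) ^ i) * ascSeries (-(i * α)) := by
    rw [sibuyaSeries, sub_eq_neg_add, add_pow]
    refine Finset.sum_congr rfl fun i _ => ?_
    rw [← mul_neg, ascSeries_natCast_mul, neg_pow]
    simp
    ring
  rw [sibuyaSum, h, map_sum]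
  exact Finset.sum_congr rfl fun i _ => by
    rw [PowerSeries.coeff_C_mul, ascSeries, PowerSeries.coeff_mk]

lemma genFact_eq (α : ℝ) (n k : ℕ) :
    genFact n k α = n.factorial / k.factorial * sibuyaSum α n k := by
  have : (n.factorial : ℝ) ≠ 0 := by positivity
  rw [genFact, sibuyaSum_eq_sum, div_mul_eq_mul_div, div_mul_eq_mul_div, one_mul, Finset.mul_sum]
  congr 1
  refine Finset.sum_congr rfl fun i _ => ?_
  field_simp

lemma sibuyaSum_add (α : ℝ) (n k l : ℕ) :
    sibuyaSum α n (k + l) =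
      ∑ m ∈ Finset.range (n + 1), sibuyaSum α m k * sibuyaSum α (n - m) l := by
  rw [sibuyaSum, pow_add, PowerSeries.coeff_mul,
    Finset.Nat.sum_antidiagonal_eq_sum_range_succ_mk]
  rfl

lemma sibuyaSum_one_zero (α : ℝ) : sibuyaSum α 0 1 = 0 := by
  simp [sibuyaSum, sibuyaSeries, ascSeries, ascFact]

lemma sibuyaSum_one_succ_pos {α : ℝ} (hα : α ∈ Set.Ioo (0 : ℝ) 1) (n : ℕ) :
    0 < sibuyaSum α (n + 1) 1 := by
  have h : sibuyaSum α (n + 1) 1 = α * ascFact (1 - α) n / (n + 1).factorial := by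
    simp only [sibuyaSum, sibuyaSeries, ascSeries, pow_one, map_sub, PowerSeries.coeff_mk,
      ascFact_succ_left, PowerSeries.coeff_one, Nat.add_eq_zero_iff, one_ne_zero, and_false, if_false]
    rw [neg_add_eq_sub]
    ring
  rw [h]
  have := ascFact_pos (sub_pos.2 hα.2) n
  have := hα.1
  positivity

lemma sibuyaSum_one_nonneg {α : ℝ} (hα : α ∈ Set.Ioo (0 : ℝ) 1) (n : ℕ) :
    0 ≤ sibuyaSum α n 1 := by
  cases n with
  | zero => rw [sibuyaSum_one_zero]
  | succ n => exact (sibuyaSum_one_succ_pos hα n).le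

lemma sum_sibuyaSum_one_le {α : ℝ} (hα : α ∈ Set.Ioo (0 : ℝ) 1) (n : ℕ) :
    ∑ m ∈ Finset.range (n + 1), sibuyaSum α m 1 ≤ 1 := by
  have h : ∀ n : ℕ, ∑ m ∈ Finset.range (n + 1), sibuyaSum α m 1 =
      1 - ascFact (1 - α) n / n.factorial := by
    intro n
    induction n with
    | zero => simp [sibuyaSum_one_zero, ascFact]
    | succ n ih =>
      rw [Finset.sum_range_succ, ih]
      simp only [sibuyaSum, sibuyaSeries, ascSeries, pow_one, map_sub, PowerSeries.coeff_mk,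
        PowerSeries.coeff_one, Nat.add_eq_zero_iff, one_ne_zero, and_false, if_false]
      rw [ascFact_succ_left, neg_add_eq_sub, ascFact_succ, Nat.factorial_succ]
      have : (n.factorial : ℝ) ≠ 0 := by positivity
      push_cast
      field_simp
      ring
  rw [h]
  have := ascFact_pos (sub_pos.2 hα.2) n
  have : 0 ≤ ascFact (1 - α) n / n.factorial := by positivity
  linarith

lemma sibuyaSum_nonneg {α : ℝ} (hα : α ∈ Set.Ioo (0 : ℝ) 1) (n k : ℕ) :
    0 ≤ sibuyaSum α n k := by
  induction k generalizing n with
  | zero => simp only [sibuyaSum, pow_zero, PowerSeries.coeff_one]; split_ifs <;> norm_num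
  | succ k ih =>
    rw [sibuyaSum_add]
    exact Finset.sum_nonneg fun m _ => mul_nonneg (ih m) (sibuyaSum_one_nonneg hα _)

lemma sibuyaSum_le_one {α : ℝ} (hα : α ∈ Set.Ioo (0 : ℝ) 1) (n k : ℕ) :
    sibuyaSum α n k ≤ 1 := by
  induction k generalizing n with
  | zero => simp only [sibuyaSum, pow_zero, PowerSeries.coeff_one]; split_ifs <;> norm_num
  | succ k ih =>
    rw [add_comm, sibuyaSum_add]
    refine le_trans (Finset.sum_le_sum fun m _ => ?_) (sum_sibuyaSum_one_le hα n)
    exact mul_le_of_le_one_right (sibuyaSum_one_nonneg hα _) (ih _)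

lemma sibuyaSum_eq_zero_of_lt (α : ℝ) {n k : ℕ} (h : n < k) : sibuyaSum α n k = 0 := by
  have hX : (PowerSeries.X : PowerSeries ℝ) ∣ sibuyaSeries α := by
    rw [PowerSeries.X_dvd_iff, ← PowerSeries.coeff_zero_eq_constantCoeff_apply]
    simpa [sibuyaSum] using sibuyaSum_one_zero α
  exact PowerSeries.X_pow_dvd_iff.1 (pow_dvd_pow_of_dvd hX k) n h

lemma abs_ascFact_neg_floor_le {x : ℝ} {m : ℕ} (h1 : (m : ℝ) ≤ x) (h2 : x < m + 1) :
    |ascFact (-x) (m + 1)| ≤ x * m.factorial := by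
  have hx : 0 ≤ x := (Nat.cast_nonneg m).trans h1
  rw [ascFact_succ_left, abs_mul, abs_neg, abs_of_nonneg hx]
  refine mul_le_mul_of_nonneg_left ?_ hx
  rw [← Finset.prod_range_add_one_eq_factorial, ← Finset.prod_range_reflect, ascFact,
    Finset.abs_prod, Nat.cast_prod]
  refine Finset.prod_le_prod (fun _ _ => abs_nonneg _) fun i hi => ?_
  have him : i + 1 ≤ m := Finset.mem_range.1 hi
  have h3 : m - 1 - i + 1 = m - i := by omega
  have him' : (i : ℝ) + 1 ≤ m := by exact_mod_cast him
  rw [h3, Nat.cast_sub (by omega), abs_of_nonpos (by linarith)]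
  linarith

lemma mul_abs_ascFact_neg_le {x : ℝ} {m n : ℕ} (h1 : (m : ℝ) ≤ x) (h2 : x < m + 1)
    (hmn : m + 1 ≤ n) :
    n * (|ascFact (-x) n| / n.factorial) ≤ x * (((m : ℝ) + 1) / n) ^ x := by
  have hx : 0 ≤ x := (Nat.cast_nonneg m).trans h1
  induction n, hmn using Nat.le_induction with
  | base =>
    have h := abs_ascFact_neg_floor_le h1 h2
    have hm : (m : ℝ) + 1 ≠ 0 := by positivity
    have hf : (0 : ℝ) < m.factorial := by positivity
    push_cast [Nat.factorial_succ]
    rw [div_self hm, Real.one_rpow, mul_one, ← mul_div_assoc, mul_div_mul_left _ _ hm,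
      div_le_iff₀ hf]
    exact h
  | succ n hn ih =>
    have hn' : (m : ℝ) + 1 ≤ n := by exact_mod_cast hn
    have hn0 : (0 : ℝ) < n := by linarith [(Nat.cast_nonneg m : (0 : ℝ) ≤ m)]
    have hm0 : (0 : ℝ) < m + 1 := by positivity
    have hxn : 0 ≤ 1 - x / n := by
      rw [sub_nonneg, div_le_one hn0]; linarith
    have e1 : ((n + 1 : ℕ) : ℝ) * (|ascFact (-x) (n + 1)| / (n + 1).factorial) =
        n * (|ascFact (-x) n| / n.factorial) * (1 - x / n) := by
      have hf : (n.factorial : ℝ) ≠ 0 := by positivity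
      rw [ascFact_succ, abs_mul, abs_of_nonneg (by linarith : 0 ≤ -x + (n : ℝ))]
      push_cast [Nat.factorial_succ]
      field_simp
      ring
    rw [e1]
    refine (mul_le_mul_of_nonneg_right ih hxn).trans ?_
    rw [mul_assoc]
    refine mul_le_mul_of_nonneg_left ?_ hx
    have e2 : ((m : ℝ) + 1) / n = (m + 1) / ((n + 1 : ℕ) : ℝ) * (1 + 1 / n) := by
      push_cast; field_simp
    rw [e2, Real.mul_rpow (by positivity) (by positivity), mul_assoc]
    refine mul_le_of_le_one_right (by positivity) ?_
    have e3 : (1 + 1 / (n : ℝ)) ^ x ≤ Real.exp (x / n) := by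
      have : Real.exp (x / n) = Real.exp (1 / n) ^ x := by
        rw [← Real.exp_mul]; congr 1; ring
      rw [this]
      refine Real.rpow_le_rpow (by positivity) ?_ hx
      linarith [Real.add_one_le_exp (1 / (n : ℝ))]
    have e4 : 1 - x / n ≤ Real.exp (-(x / n)) := by
      linarith [Real.add_one_le_exp (-(x / n))]
    calc (1 + 1 / (n : ℝ)) ^ x * (1 - x / n)
        ≤ Real.exp (x / n) * Real.exp (-(x / n)) := by gcongr
      _ = 1 := by rw [← Real.exp_add]; simp

lemma mul_abs_ascFact_neg_le' {x : ℝ} {n : ℕ} (hx : 0 ≤ x) (hn : x < n) :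
    n * (|ascFact (-x) n| / n.factorial) ≤ x * (x + 1) ^ x / (n : ℝ) ^ x := by
  have hm := Nat.floor_le hx
  refine (mul_abs_ascFact_neg_le hm (Nat.lt_floor_add_one x)
    (Nat.succ_le_of_lt ((Nat.floor_lt hx).2 hn))).trans ?_
  rw [mul_div_assoc, ← Real.div_rpow (by positivity) (by positivity)]
  gcongr

lemma tendsto_mul_ascFact_neg (x : ℝ) :
    Tendsto (fun n : ℕ => n * (ascFact (-x) n / n.factorial) * (n : ℝ) ^ x) atTop
      (𝓝 (Real.Gamma (-x))⁻¹) := by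
  by_cases hG : Real.Gamma (-x) = 0
  · obtain ⟨m, hm⟩ := (Real.Gamma_eq_zero_iff _).1 hG
    rw [hG, inv_zero]
    refine tendsto_const_nhds.congr' ?_
    filter_upwards [eventually_gt_atTop m] with n hn
    have : ascFact (-x) n = 0 :=
      Finset.prod_eq_zero (Finset.mem_range.2 hn) (by rw [hm]; ring)
    simp [this]
  · have h1 := (Real.GammaSeq_tendsto_Gamma (-x)).inv₀ hG
    have h2 : Tendsto (fun n : ℕ => (1 - x / (n : ℝ))⁻¹) atTop (𝓝 (1 - 0)⁻¹) :=
      ((tendsto_const_div_atTop_nhds_zero_nat x).const_sub 1).inv₀ (by norm_num)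
    have h3 := h1.mul h2
    rw [sub_zero, inv_one, mul_one] at h3
    refine h3.congr' ?_
    obtain ⟨M, hM⟩ := exists_nat_gt x
    filter_upwards [eventually_gt_atTop M, eventually_gt_atTop 0] with n hn hn0
    have hn0' : (0 : ℝ) < n := by exact_mod_cast hn0
    have hn' : (M : ℝ) < n := by exact_mod_cast hn
    have hxn : (n : ℝ) - x ≠ 0 := by linarith
    have hp : (0 : ℝ) < (n : ℝ) ^ x := by positivity
    have hf : (n.factorial : ℝ) ≠ 0 := by positivity
    have hq : 1 - x / (n : ℝ) = (n - x) / n := by field_simp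
    rw [Real.GammaSeq, Finset.prod_range_succ, Real.rpow_neg hn0'.le, hq, inv_div]
    rw [inv_div, ← ascFact]
    field_simp
    ring

lemma tendsto_choose_div {ι : Type*} {l : Filter ι} {K : ι → ℕ} {w : ι → ℝ} {s : ℝ}
    (hw : Tendsto w l atTop) (hK : Tendsto (fun i => (K i : ℝ) / w i) l (𝓝 s)) (j : ℕ) :
    Tendsto (fun i => ((K i).choose j : ℝ) / w i ^ j) l (𝓝 (s ^ j / j.factorial)) := by
  have h1 : Tendsto (fun i => ∏ r ∈ Finset.range j, ((K i : ℝ) / w i - r / w i)) l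
      (𝓝 (∏ _r ∈ Finset.range j, (s - 0))) :=
    tendsto_finsetProd _ fun r _ => hK.sub (hw.const_div_atTop _)
  simp only [sub_zero, Finset.prod_const, Finset.card_range] at h1
  refine (h1.div_const _).congr fun i => ?_
  have h2 : ((K i).choose j : ℝ) = (∏ r ∈ Finset.range j, ((K i : ℝ) - r)) / j.factorial := by
    rw [← descPochhammer_eval_eq_prod_range, descPochhammer_eval_eq_descFactorial,
      Nat.descFactorial_eq_factorial_mul_choose, Nat.cast_mul, mul_div_cancel_left₀ _ (by positivity)]
  rw [h2]
  simp_rw [← sub_div]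
  rw [Finset.prod_div_distrib, Finset.prod_const, Finset.card_range]
  ring

/-- The limit of `n * sibuyaSum α n k` when `k ∼ s * n ^ α`. -/
noncomputable def sibuyaLimit (α s : ℝ) : ℝ :=
  ∑' i : ℕ, s ^ i / i.factorial * (-1) ^ i * (Real.Gamma (-(i * α)))⁻¹

lemma summable_sibuya_bound {α : ℝ} (hα : α ∈ Set.Ioo (0 : ℝ) 1) {C : ℝ} (hC : 0 < C) :
    Summable fun i : ℕ => C ^ i / i.factorial * (i * α * (i * α + 1) ^ (i * α)) := by
  have hβ : 0 < 1 - α := sub_pos.2 hα.2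
  have h0 : 0 < α := hα.1
  have h1 : Summable fun i : ℕ => (2 * C * Real.exp 1) ^ i / (i.factorial : ℝ) ^ (1 - α) := by
    refine summable_of_ratio_test_tendsto_lt_one (l := 0) one_pos
      (Eventually.of_forall fun i => by positivity) ?_
    have h2 : Tendsto (fun i : ℕ => (2 * C * Real.exp 1) / ((i + 1 : ℕ) : ℝ) ^ (1 - α))
        atTop (𝓝 0) :=
      Tendsto.const_div_atTop (((tendsto_rpow_atTop hβ).comp tendsto_natCast_atTop_atTop).comp
        (tendsto_add_atTop_nat 1)) _
    refine h2.congr fun i => ?_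
    have hf : (0 : ℝ) < i.factorial := by positivity
    rw [Real.norm_of_nonneg (by positivity), Real.norm_of_nonneg (by positivity),
      Nat.factorial_succ, Nat.cast_mul, Real.mul_rpow (by positivity) (by positivity), pow_succ]
    have : (0 : ℝ) < (i.factorial : ℝ) ^ (1 - α) := by positivity
    have : (0 : ℝ) < ((i + 1 : ℕ) : ℝ) ^ (1 - α) := by positivity
    field_simp
  refine Summable.of_nonneg_of_le (fun i => by positivity) (fun i => ?_)
    (h1.mul_left (Real.exp 1))
  have hf : (0 : ℝ) < i.factorial := by positivity
  have hi : (0 : ℝ) ≤ i := by positivity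
  have hiα : i * α ≤ i := mul_le_of_le_one_right hi hα.2.le
  have e1 : ((i : ℝ) + 1) ^ i ≤ Real.exp (i + 1) * i.factorial := by
    have := Real.pow_div_factorial_le_exp ((i : ℝ) + 1) (by positivity) (i + 1)
    rw [div_le_iff₀ (by positivity), Nat.factorial_succ, pow_succ] at this
    push_cast at this
    have h3 : (0 : ℝ) < i + 1 := by positivity
    nlinarith [this]
  have e2 : (i * α + 1) ^ (i * α) ≤ Real.exp (i + 1) * (i.factorial : ℝ) ^ α := by
    calc (i * α + 1) ^ (i * α) ≤ ((i : ℝ) + 1) ^ (i * α) := by gcongr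
      _ = (((i : ℝ) + 1) ^ i) ^ α := by rw [Real.rpow_mul (by positivity), Real.rpow_natCast]
      _ ≤ (Real.exp (i + 1) * i.factorial) ^ α := by gcongr
      _ = Real.exp (i + 1) ^ α * (i.factorial : ℝ) ^ α := Real.mul_rpow (by positivity) hf.le
      _ ≤ Real.exp (i + 1) * (i.factorial : ℝ) ^ α := by
        gcongr
        rw [← Real.exp_mul, Real.exp_le_exp]
        exact mul_le_of_le_one_right (by positivity) hα.2.le
  have e3 : i * α ≤ 2 ^ i := hiα.trans (by exact_mod_cast (Nat.lt_two_pow_self (n := i)).le)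
  have e4 : (i.factorial : ℝ) ^ (1 - α) = i.factorial / (i.factorial : ℝ) ^ α := by
    rw [Real.rpow_sub hf, Real.rpow_one]
  calc C ^ i / i.factorial * (i * α * (i * α + 1) ^ (i * α))
      ≤ C ^ i / i.factorial * (2 ^ i * (Real.exp (i + 1) * (i.factorial : ℝ) ^ α)) := by gcongr
    _ = _ := by
      rw [e4, mul_pow, mul_pow, ← Real.exp_nat_mul, Real.exp_add]
      field_simp

lemma tendsto_mul_sibuyaSum {α : ℝ} (hα : α ∈ Set.Ioo (0 : ℝ) 1) {ι : Type*} {l : Filter ι}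
    {N K : ι → ℕ} {s : ℝ} (hN : Tendsto N l atTop)
    (hK : Tendsto (fun i => (K i : ℝ) / (N i : ℝ) ^ α) l (𝓝 s)) :
    Tendsto (fun i => N i * sibuyaSum α (N i) (K i)) l (𝓝 (sibuyaLimit α s)) := by
  have h0 : 0 < α := hα.1
  have hNr : Tendsto (fun i => (N i : ℝ)) l atTop := tendsto_natCast_atTop_atTop.comp hN
  have hNα : Tendsto (fun i => (N i : ℝ) ^ α) l atTop := (tendsto_rpow_atTop h0).comp hNr
  obtain ⟨C, hC0, hC⟩ : ∃ C : ℝ, 0 < C ∧ s < C :=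
    ⟨max 0 s + 1, by positivity, by linarith [le_max_right 0 s]⟩
  have hsum : ∀ i, N i * sibuyaSum α (N i) (K i) = ∑' j : ℕ, ((K i).choose j : ℝ) * (-1) ^ j *
      (N i * (ascFact (-(j * α)) (N i) / (N i).factorial)) := by
    intro i
    rw [tsum_eq_sum (s := Finset.range (K i + 1)), sibuyaSum_eq_sum, Finset.mul_sum]
    · exact Finset.sum_congr rfl fun j _ => by ring
    · intro j hj
      rw [Nat.choose_eq_zero_of_lt (by simpa [Nat.lt_succ_iff] using hj)]
      simp
  simp_rw [hsum]
  refine tendsto_tsum_of_dominated_convergence (summable_sibuya_bound hα hC0) (fun j => ?_) ?_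
  · have h1 := (tendsto_choose_div hNα hK j).mul_const ((-1 : ℝ) ^ j)
    have h2 := h1.mul ((tendsto_mul_ascFact_neg (j * α)).comp hN)
    refine h2.congr' ?_
    filter_upwards [hN.eventually_gt_atTop 0] with i hi
    have hi' : (0 : ℝ) < N i := by exact_mod_cast hi
    have : (N i : ℝ) ^ (j * α) = ((N i : ℝ) ^ α) ^ j := by
      rw [mul_comm, Real.rpow_mul hi'.le, Real.rpow_natCast]
    have hp : (0 : ℝ) < ((N i : ℝ) ^ α) ^ j := by positivity
    simp only [Function.comp_apply]
    rw [this]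
    field_simp
  · have hsmall : ∀ᶠ i in l, C < (N i : ℝ) ^ (1 - α) :=
      ((tendsto_rpow_atTop (sub_pos.2 hα.2)).comp hNr).eventually_gt_atTop C
    filter_upwards [hN.eventually_gt_atTop 0, hK.eventually_lt_const hC, hsmall] with i hi hKi hsm j
    have hi' : (0 : ℝ) < N i := by exact_mod_cast hi
    have hpa : (0 : ℝ) < (N i : ℝ) ^ α := by positivity
    have hKi' : (K i : ℝ) ≤ C * (N i : ℝ) ^ α := ((div_lt_iff₀ hpa).1 hKi).le
    by_cases hj : K i < j
    · rw [Nat.choose_eq_zero_of_lt hj]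
      simp only [Nat.cast_zero, zero_mul, norm_zero]
      positivity
    · have hjK : (j : ℝ) ≤ K i := by exact_mod_cast not_lt.1 hj
      have hlt : C * (N i : ℝ) ^ α < N i := by
        have : (N i : ℝ) = (N i : ℝ) ^ (1 - α) * (N i : ℝ) ^ α := by
          rw [← Real.rpow_add hi']; simp
        rw [this, ← this]
        nlinarith
      have hjN : j * α < N i := by
        have : j * α ≤ j := mul_le_of_le_one_right (by positivity) hα.2.le
        linarith
      have hb := mul_abs_ascFact_neg_le' (by positivity : 0 ≤ j * α) hjN
      have hc : ((K i).choose j : ℝ) ≤ (C * (N i : ℝ) ^ α) ^ j / j.factorial :=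
        (Nat.choose_le_pow_div j (K i)).trans (by gcongr)
      have hpj : (N i : ℝ) ^ (j * α) = ((N i : ℝ) ^ α) ^ j := by
        rw [mul_comm, Real.rpow_mul hi'.le, Real.rpow_natCast]
      rw [norm_mul, norm_mul, norm_pow, norm_neg, norm_one, one_pow, mul_one, norm_mul,
        Real.norm_natCast, Real.norm_natCast, norm_div, Real.norm_natCast, Real.norm_eq_abs]
      refine (mul_le_mul hc hb (by positivity) (by positivity)).trans_eq ?_
      rw [hpj, mul_pow]
      field_simp

lemma abs_inv_Gamma_neg_le {x : ℝ} (hx : 0 ≤ x) :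
    |(Real.Gamma (-x))⁻¹| ≤ x * (x + 1) ^ x := by
  refine le_of_tendsto (tendsto_mul_ascFact_neg x).abs ?_
  obtain ⟨M, hM⟩ := exists_nat_gt x
  filter_upwards [eventually_gt_atTop M, eventually_gt_atTop 0] with n hn hn0
  have hn0' : (0 : ℝ) < n := by exact_mod_cast hn0
  have hn' : (M : ℝ) < n := by exact_mod_cast hn
  have hp : (0 : ℝ) < (n : ℝ) ^ x := by positivity
  have h := mul_abs_ascFact_neg_le' hx (hM.trans hn')
  rw [le_div_iff₀ hp] at h
  rwa [abs_mul, abs_mul, abs_div, Nat.abs_cast, Nat.abs_cast, abs_of_pos hp]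

lemma exists_sibuyaLimit_pos {α : ℝ} (hα : α ∈ Set.Ioo (0 : ℝ) 1) :
    ∃ s₀ > 0, ∀ s, 0 < s → s < s₀ → 0 < sibuyaLimit α s := by
  have h0 : 0 < α := hα.1
  set d : ℕ → ℝ := fun i => (-1) ^ i / i.factorial * (Real.Gamma (-(i * α)))⁻¹ with hd
  have hdabs : Summable fun i => |d i| := by
    refine Summable.of_nonneg_of_le (fun _ => abs_nonneg _) (fun i => ?_)
      (summable_sibuya_bound hα one_pos)
    rw [hd, abs_mul, abs_div, abs_pow, abs_neg, abs_one, Nat.abs_cast, one_pow]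
    exact mul_le_mul_of_nonneg_left (abs_inv_Gamma_neg_le (by positivity)) (by positivity)
  have hd0 : d 0 = 0 := by simp [hd]
  have hd1 : 0 < d 1 := by
    have h1 : Real.Gamma (-α + 1) = -α * Real.Gamma (-α) := Real.Gamma_add_one (by linarith)
    have h2 : 0 < Real.Gamma (-α + 1) := Real.Gamma_pos_of_pos (by linarith [hα.2])
    have h3 : Real.Gamma (-α) < 0 := by nlinarith
    have h4 := inv_lt_zero.2 h3
    simp only [hd, Nat.cast_one, one_mul, pow_one, Nat.factorial_one, div_one]
    linarith
  set B : ℝ := ∑' i, |d (i + 2)| with hB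
  have hB2 : Summable fun i => |d (i + 2)| := (summable_nat_add_iff 2).2 hdabs
  have hB0 : 0 ≤ B := tsum_nonneg fun _ => abs_nonneg _
  refine ⟨min 1 (d 1 / (B + 1)), by positivity, fun s hs hs' => ?_⟩
  have hs1 : s < 1 := hs'.trans_le (min_le_left _ _)
  have hs2 : s * (B + 1) < d 1 :=
    (lt_div_iff₀ (by positivity)).1 (hs'.trans_le (min_le_right _ _))
  have hle : ∀ i, |s ^ i * d i| ≤ |d i| := fun i => by
    rw [abs_mul, abs_of_pos (pow_pos hs i)]
    exact mul_le_of_le_one_left (abs_nonneg _) (pow_le_one₀ hs.le hs1.le)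
  have hsum : Summable fun i => s ^ i * d i := Summable.of_norm_bounded hdabs hle
  have hlim : sibuyaLimit α s = ∑' i, s ^ i * d i :=
    tsum_congr fun i => by rw [hd]; ring
  have htail : -(s ^ 2 * B) ≤ ∑' i, s ^ (i + 2) * d (i + 2) := by
    rw [hB, ← tsum_mul_left, ← tsum_neg]
    refine (hB2.mul_left _).neg.tsum_le_tsum (fun i => ?_) ((summable_nat_add_iff 2).2 hsum)
    have h1 : |s ^ (i + 2) * d (i + 2)| ≤ s ^ 2 * |d (i + 2)| := by
      rw [abs_mul, abs_of_pos (by positivity)]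
      exact mul_le_mul_of_nonneg_right
        (pow_le_pow_of_le_one hs.le hs1.le (by omega)) (abs_nonneg _)
    exact (abs_le.1 h1).1
  rw [hlim, ← hsum.sum_add_tsum_nat_add 2, Finset.sum_range_succ, Finset.sum_range_one, hd0,
    pow_one]
  nlinarith

/-- The filter of pairs `(n, k)` with `n → ∞` and `k / n ^ α → s`. -/
noncomputable def ratioFilter (α s : ℝ) : Filter (ℕ × ℕ) :=
  comap Prod.fst atTop ⊓ comap (fun p : ℕ × ℕ => (p.2 : ℝ) / (p.1 : ℝ) ^ α) (𝓝 s)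

lemma tendsto_mul_sibuyaSum_ratioFilter {α : ℝ} (hα : α ∈ Set.Ioo (0 : ℝ) 1) (s : ℝ) :
    Tendsto (fun p : ℕ × ℕ => p.1 * sibuyaSum α p.1 p.2) (ratioFilter α s)
      (𝓝 (sibuyaLimit α s)) :=
  tendsto_mul_sibuyaSum hα (N := Prod.fst) (K := Prod.snd)
    (tendsto_comap.mono_left inf_le_left) (tendsto_comap.mono_left inf_le_right)

lemma exists_forall_abs_sub_lt_of_tendsto {α s L : ℝ} {F : ℕ × ℕ → ℝ}
    (hF : Tendsto F (ratioFilter α s) (𝓝 L)) {ε : ℝ} (hε : 0 < ε) :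
    ∃ η > 0, ∃ n₀ : ℕ, ∀ n ≥ n₀, ∀ k : ℕ, |(k : ℝ) / (n : ℝ) ^ α - s| < η →
      |F (n, k) - L| < ε := by
  have h1 := Metric.tendsto_nhds.1 hF ε hε
  rw [ratioFilter, ((atTop_basis.comap _).inf (Metric.nhds_basis_ball.comap _)).eventually_iff]
    at h1
  obtain ⟨⟨n₀, η⟩, ⟨_, hη⟩, h2⟩ := h1
  exact ⟨η, hη, n₀, fun n hn k hk => h2 (x := (n, k)) ⟨hn, hk⟩⟩

lemma sibuyaLimit_pos_of_scaled_pos {α : ℝ} (hα : α ∈ Set.Ioo (0 : ℝ) 1) {t : ℝ} (ht : 0 < t)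
    (h : 0 < sibuyaLimit α (t * 2 ^ (α - 1))) : 0 < sibuyaLimit α t := by
  have h0 : 0 < α := hα.1
  set s := t * 2 ^ (α - 1) with hs
  obtain ⟨η, hη, n₀, hloc⟩ :=
    exists_forall_abs_sub_lt_of_tendsto (tendsto_mul_sibuyaSum_ratioFilter hα s) (half_pos h)
  set c := sibuyaLimit α s / 2 with hc
  have hlow : ∀ n ≥ n₀, ∀ k : ℕ, |(k : ℝ) / (n : ℝ) ^ α - s| < η → c ≤ n * sibuyaSum α n k := by
    intro n hn k hk
    have := (abs_lt.1 (hloc n hn k hk)).1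
    linarith
  -- a window around `(s, 1)` on which `u / v ^ α` stays close to `s`
  obtain ⟨δ, hδ0, hδ1, hδ⟩ : ∃ δ > 0, δ ≤ 1 / 2 ∧ ∀ u v : ℝ, |u - s| < δ → |v - 1| ≤ δ →
      |u / v ^ α - s| < η := by
    have hcont : ContinuousAt (fun p : ℝ × ℝ => p.1 / p.2 ^ α) (s, 1) :=
      continuousAt_fst.div (continuousAt_snd.rpow_const (Or.inl (by simp))) (by simp)
    obtain ⟨δ, hδ, hball⟩ := Metric.continuousAt_iff.1 hcont η hη
    refine ⟨min (δ / 2) (1 / 2), by positivity, min_le_right _ _, fun u v hu hv => ?_⟩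
    have := hball (x := (u, v)) (by
      rw [Prod.dist_eq, Real.dist_eq, Real.dist_eq]
      have := min_le_left (δ / 2) (1 / 2)
      exact max_lt (by simp only; linarith) (by simp only; linarith))
    simpa [Real.dist_eq] using this
  have hNr : Tendsto (fun p : ℕ => (((2 * p : ℕ) : ℝ)) ^ α) atTop atTop :=
    (tendsto_rpow_atTop h0).comp (tendsto_natCast_atTop_atTop.comp
      (tendsto_id.const_mul_atTop' two_pos))
  let L : ℕ → ℕ := fun p => ⌊t / 2 * ((2 * p : ℕ) : ℝ) ^ α⌋₊
  have hL : Tendsto (fun p => (L p : ℝ) / ((2 * p : ℕ) : ℝ) ^ α) atTop (𝓝 (t / 2)) :=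
    (tendsto_nat_floor_mul_div_atTop (by positivity : 0 ≤ t / 2)).comp hNr
  have hK : Tendsto (fun p => ((L p + L p : ℕ) : ℝ) / ((2 * p : ℕ) : ℝ) ^ α) atTop (𝓝 t) := by
    have := hL.add hL
    rw [add_halves] at this
    exact this.congr fun p => by push_cast; ring
  have hmain := tendsto_mul_sibuyaSum hα (N := fun p => 2 * p) (K := fun p => L p + L p)
    (tendsto_id.const_mul_atTop' two_pos) hK
  have hLs : Tendsto (fun p => (L p : ℝ) / (p : ℝ) ^ α) atTop (𝓝 s) := by
    have h1 := hL.mul_const ((2 : ℝ) ^ α)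
    have h2 : t / 2 * 2 ^ α = s := by
      rw [hs, Real.rpow_sub two_pos, Real.rpow_one]; ring
    rw [h2] at h1
    refine h1.congr' ?_
    filter_upwards [eventually_gt_atTop 0] with p hp
    have hp' : (0 : ℝ) < p := by exact_mod_cast hp
    push_cast
    rw [Real.mul_rpow two_pos.le hp'.le]
    field_simp
  refine lt_of_lt_of_le (by positivity : 0 < δ * c ^ 2 / 2) (ge_of_tendsto hmain ?_)
  filter_upwards [eventually_gt_atTop 0, eventually_ge_atTop (2 * n₀),
    Metric.tendsto_nhds.1 hLs δ hδ0] with p hp hpn hLp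
  have hp' : (0 : ℝ) < p := by exact_mod_cast hp
  set J := ⌊δ * p⌋₊ with hJ
  have hJle : (J : ℝ) ≤ δ * p := Nat.floor_le (by positivity)
  have hJp : 2 * J ≤ p := by
    have : (2 * J : ℝ) ≤ p := by nlinarith
    exact_mod_cast this
  have hJlt : δ * p < (J + 1 : ℕ) := by push_cast; exact Nat.lt_floor_add_one _
  have hcell : ∀ m : ℕ, p - J ≤ m → m ≤ p + J → c / (2 * p) ≤ sibuyaSum α m (L p) := by
    intro m hm1 hm2
    have hm1' : (p : ℝ) - J ≤ m := by
      have : p ≤ m + J := by omega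
      have : (p : ℝ) ≤ m + J := by exact_mod_cast this
      linarith
    have hm2' : (m : ℝ) ≤ p + J := by exact_mod_cast hm2
    have hm0 : (0 : ℝ) < m := by
      have : 0 < m := by omega
      exact_mod_cast this
    have hv : |(m : ℝ) / p - 1| ≤ δ := by
      have e : (m : ℝ) / p - 1 = (m - p) / p := by field_simp
      rw [e, abs_div, abs_of_pos hp', div_le_iff₀ hp', abs_le]
      constructor <;> linarith
    have h1 := hδ _ _ hLp hv
    have e : (L p : ℝ) / (p : ℝ) ^ α / ((m : ℝ) / p) ^ α = L p / (m : ℝ) ^ α := by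
      rw [Real.div_rpow hm0.le hp'.le]
      have : (0 : ℝ) < (p : ℝ) ^ α := by positivity
      field_simp
    rw [e] at h1
    have h2 := hlow m (by omega) _ h1
    have h3 : (m : ℝ) ≤ 2 * p := by
      have : m ≤ 2 * p := by omega
      exact_mod_cast this
    rw [div_le_iff₀ (by positivity), mul_comm]
    exact h2.trans (mul_le_mul_of_nonneg_right h3 (sibuyaSum_nonneg hα _ _))
  have hconv : ((J + 1 : ℕ) : ℝ) * (c / (2 * p)) ^ 2 ≤ sibuyaSum α (2 * p) (L p + L p) := by
    rw [sibuyaSum_add]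
    calc ((J + 1 : ℕ) : ℝ) * (c / (2 * p)) ^ 2
        = ∑ m ∈ Finset.Icc p (p + J), (c / (2 * p)) ^ 2 := by
          rw [Finset.sum_const, Nat.card_Icc, nsmul_eq_mul]
          congr 2; omega
      _ ≤ ∑ m ∈ Finset.Icc p (p + J), sibuyaSum α m (L p) * sibuyaSum α (2 * p - m) (L p) := by
          refine Finset.sum_le_sum fun m hm => ?_
          rw [Finset.mem_Icc] at hm
          rw [sq]
          exact mul_le_mul (hcell m (by omega) (by omega)) (hcell _ (by omega) (by omega))
            (by positivity) (sibuyaSum_nonneg hα _ _)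
      _ ≤ _ := by
          refine Finset.sum_le_sum_of_subset_of_nonneg (fun m hm => ?_) fun m _ _ =>
            mul_nonneg (sibuyaSum_nonneg hα _ _) (sibuyaSum_nonneg hα _ _)
          rw [Finset.mem_Icc] at hm
          rw [Finset.mem_range]
          omega
  calc δ * c ^ 2 / 2 = 2 * p * (δ * p * (c / (2 * p)) ^ 2) := by field_simp
    _ ≤ 2 * p * (((J + 1 : ℕ) : ℝ) * (c / (2 * p)) ^ 2) := by gcongr
    _ ≤ 2 * p * sibuyaSum α (2 * p) (L p + L p) := by gcongr
    _ = _ := by push_cast; ring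

lemma sibuyaLimit_pos {α : ℝ} (hα : α ∈ Set.Ioo (0 : ℝ) 1) {t : ℝ} (ht : 0 < t) :
    0 < sibuyaLimit α t := by
  obtain ⟨s₀, hs₀, hsmall⟩ := exists_sibuyaLimit_pos hα
  have hr : (2 : ℝ) ^ (α - 1) < 1 :=
    Real.rpow_lt_one_of_one_lt_of_neg one_lt_two (by linarith [hα.2])
  have hr0 : (0 : ℝ) < 2 ^ (α - 1) := by positivity
  obtain ⟨m, hm⟩ := exists_pow_lt_of_lt_one (by positivity : 0 < s₀ / t) hr
  have hm' : t * ((2 : ℝ) ^ (α - 1)) ^ m < s₀ := by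
    rw [lt_div_iff₀ ht] at hm; linarith
  clear hm
  induction m generalizing t with
  | zero => exact hsmall t ht (by simpa using hm')
  | succ m ih =>
    refine sibuyaLimit_pos_of_scaled_pos hα ht (ih (by positivity) ?_)
    rwa [mul_assoc, ← pow_succ']

/-- The Poisson weight `e^{-z} z ^ j / j!`. -/
noncomputable def poissonWeight (z : ℝ) (j : ℕ) : ℝ := Real.exp (-z) * z ^ j / j.factorial

lemma poissonWeight_nonneg {z : ℝ} (hz : 0 ≤ z) (j : ℕ) : 0 ≤ poissonWeight z j := by
  unfold poissonWeight; positivity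

lemma hasSum_poissonWeight_mul_pow (z u : ℝ) :
    HasSum (fun j => poissonWeight z j * u ^ j) (Real.exp (z * (u - 1))) := by
  have h : HasSum (fun j : ℕ => (z * u) ^ j / j.factorial) (Real.exp (z * u)) := by
    rw [Real.exp_eq_exp_ℝ]; exact NormedSpace.expSeries_div_hasSum_exp (z * u)
  have h1 := h.mul_left (Real.exp (-z))
  rw [← Real.exp_add] at h1
  convert! h1 using 1
  · funext j; rw [poissonWeight, mul_pow]; ring
  · congr 1; ring

lemma hasSum_poissonWeight (z : ℝ) : HasSum (poissonWeight z) 1 := by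
  simpa using hasSum_poissonWeight_mul_pow z 1

lemma hasSum_poissonWeight_mul_rpow (z : ℝ) {u : ℝ} (hu : 0 < u) :
    HasSum (fun j => poissonWeight z j * u ^ ((j : ℝ) + 1 - u * z))
      (u * Real.exp (z * (u - 1 - u * Real.log u))) := by
  convert! (hasSum_poissonWeight_mul_pow z u).mul_right (u * u ^ (-(u * z))) using 1
  · funext j
    rw [show (j : ℝ) + 1 - u * z = j + (1 + -(u * z)) by ring, Real.rpow_add hu,
      Real.rpow_add hu, Real.rpow_natCast, Real.rpow_one]
    ring
  · rw [Real.rpow_def_of_pos hu, mul_left_comm, ← Real.exp_add]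
    congr 2
    ring

lemma sub_one_sub_mul_log_neg {u : ℝ} (hu : 0 < u) (hu1 : u ≠ 1) :
    u - 1 - u * Real.log u < 0 := by
  have h := Real.log_lt_sub_one_of_pos (inv_pos.2 hu) (by simpa using hu1)
  rw [Real.log_inv] at h
  have h2 := mul_lt_mul_of_pos_left h hu
  rw [mul_sub, mul_inv_cancel₀ hu.ne'] at h2
  linarith

lemma tendsto_mul_exp_neg_zero {α t c : ℝ} (hα : 0 < α) (ht : 0 < t) (hc : c < 0) :
    Tendsto (fun n : ℕ => (n : ℝ) * (t * (n : ℝ) ^ α) * Real.exp (t * (n : ℝ) ^ α * c))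
      atTop (𝓝 0) := by
  have hy : Tendsto (fun n : ℕ => (n : ℝ) ^ α) atTop atTop :=
    (tendsto_rpow_atTop hα).comp tendsto_natCast_atTop_atTop
  have h := ((tendsto_rpow_mul_exp_neg_mul_atTop_nhds_zero (1 / α + 1) (-(t * c))
    (by nlinarith)).comp hy).const_mul t
  rw [mul_zero] at h
  refine h.congr' ?_
  filter_upwards [eventually_gt_atTop 0] with n hn
  have hn' : (0 : ℝ) < n := by exact_mod_cast hn
  simp only [Function.comp_apply]
  rw [Real.rpow_add (by positivity), Real.rpow_one, ← Real.rpow_mul hn'.le,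
    mul_one_div_cancel hα.ne', Real.rpow_one,
    show -(-(t * c)) * (n : ℝ) ^ α = t * (n : ℝ) ^ α * c by ring]
  ring

/-- If the density `r` is close to `h` off the tail `1 ≤ τ`, and the tail is negligible, then
normalizing `q * r` gives a law close to `q` in total variation. -/
lemma tsum_abs_sub_le_of_density_near_const {q r τ : ℕ → ℝ} {D E M h ε : ℝ}
    (hq : ∀ j, 0 ≤ q j) (hq1 : HasSum q 1) (hr : ∀ j, 0 ≤ r j) (hrM : ∀ j, r j ≤ M)
    (hτ : ∀ j, 0 ≤ τ j) (hE : HasSum (fun j => q j * τ j) E)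
    (hD : HasSum (fun j => q j * r j) D) (hD0 : 0 < D)
    (hbulk : ∀ j, τ j < 1 → |r j - h| < ε) (hε : 0 < ε) (hεh : ε < h) (hME : M * E ≤ ε) :
    (1 / 2) * ∑' j, |q j * r j / D - q j| ≤ 3 * ε / h + E := by
  have hh : 0 < h := hε.trans hεh
  have hM : 0 ≤ M := (hr 0).trans (hrM 0)
  have hD' : D ≤ h + 2 * ε := by
    have h1 : D ≤ (h + ε) * 1 + M * E := by
      refine hasSum_le (fun j => ?_) hD ((hq1.mul_left (h + ε)).add (hE.mul_left M))
      by_cases hj : τ j < 1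
      · have h2 := (abs_lt.1 (hbulk j hj)).2
        have h3 : 0 ≤ M * (q j * τ j) := mul_nonneg hM (mul_nonneg (hq j) (hτ j))
        nlinarith [hq j]
      · have h2 : q j * r j ≤ q j * M := mul_le_mul_of_nonneg_left (hrM j) (hq j)
        have h3 : M * q j ≤ M * (q j * τ j) :=
          mul_le_mul_of_nonneg_left (le_mul_of_one_le_right (hq j) (not_lt.1 hj)) hM
        have h4 : 0 ≤ (h + ε) * q j := mul_nonneg (by linarith) (hq j)
        linarith
    linarith
  have hκ : 0 ≤ 3 * ε / h := by positivity
  -- pointwise: `|p - q| ≤ (p - q) + 2 * (q - p)⁺`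
  have hpt : ∀ j, |q j * r j / D - q j| ≤
      (q j * r j / D - q j) + 2 * (3 * ε / h * q j + q j * τ j) := by
    intro j
    have hqτ := mul_nonneg (hq j) (hτ j)
    have hκq := mul_nonneg hκ (hq j)
    have hdef : q j - q j * r j / D ≤ 3 * ε / h * q j + q j * τ j := by
      have hp : 0 ≤ q j * r j / D := div_nonneg (mul_nonneg (hq j) (hr j)) hD0.le
      by_cases hj : τ j < 1
      · have h2 := (abs_lt.1 (hbulk j hj)).1
        have h3 : 1 - 3 * ε / h ≤ r j / D := by
          rw [le_div_iff₀ hD0]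
          have h4 : (1 - 3 * ε / h) * h = h - 3 * ε := by field_simp
          have h5 : 1 - 3 * ε / h ≤ 1 := by linarith
          by_cases h6 : 0 ≤ 1 - 3 * ε / h
          · nlinarith
          · nlinarith [hr j]
        have h7 := mul_le_mul_of_nonneg_left h3 (hq j)
        rw [mul_div_assoc]
        linarith
      · have := le_mul_of_one_le_right (hq j) (not_lt.1 hj)
        linarith
    rcases abs_cases (q j * r j / D - q j) with ⟨h1, _⟩ | ⟨h1, _⟩ <;> linarith
  have hbd := ((hD.div_const D).sub hq1).add (((hq1.mul_left (3 * ε / h)).add hE).mul_left 2)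
  rw [div_self hD0.ne'] at hbd
  have habs : Summable fun j => |q j * r j / D - q j| :=
    Summable.of_nonneg_of_le (fun _ => abs_nonneg _) hpt hbd.summable
  have := hasSum_le hpt habs.hasSum hbd
  linarith

lemma genFact_mul_pow_eq {α t : ℝ} {n : ℕ} (hn : 0 < n) (j : ℕ) :
    genFact n (j + 1) α * (t * (n : ℝ) ^ α) ^ (j + 1) =
      n.factorial * Real.exp (t * (n : ℝ) ^ α) / n * (poissonWeight (t * (n : ℝ) ^ α) j *
        (n * sibuyaSum α n (j + 1) * (t / (((j + 1 : ℕ) : ℝ) / (n : ℝ) ^ α)))) := by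
  have hn' : (0 : ℝ) < n := by exact_mod_cast hn
  have hy : (0 : ℝ) < (n : ℝ) ^ α := by positivity
  have hf : (0 : ℝ) < j.factorial := by positivity
  have hj : (0 : ℝ) < ((j + 1 : ℕ) : ℝ) := by positivity
  rw [genFact_eq, poissonWeight, Nat.factorial_succ, Nat.cast_mul, Real.exp_neg]
  have := Real.exp_pos (t * (n : ℝ) ^ α)
  field_simp
  ring

/-- for `α ∈ (0,1)` and `t > 0`, the total variation distance between the law of
`K(α, t n^α, n)` under the NB-CPSM and the law of `1 + P_{t n^α}` tends to `0` as `n → ∞`. -/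
theorem dTV_nbcpsm_shifted_poisson_tendsto_zero
    (α t : ℝ) (hα : α ∈ Set.Ioo (0 : ℝ) 1) (ht : 0 < t) :
    Tendsto (fun n : ℕ =>
        (1 / 2 : ℝ) * ∑' k : ℕ,
          |(if 1 ≤ k ∧ k ≤ n then
              genFact n k α * (t * (n : ℝ) ^ α) ^ k /
                ∑ j ∈ Finset.Icc 1 n, genFact n j α * (t * (n : ℝ) ^ α) ^ j
            else 0) -
           (if 1 ≤ k then
              Real.exp (-(t * (n : ℝ) ^ α)) * (t * (n : ℝ) ^ α) ^ (k - 1) /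
                (Nat.factorial (k - 1) : ℝ)
            else 0)|)
      atTop (𝓝 0) := by
  have h0 : 0 < α := hα.1
  set h := sibuyaLimit α t with hh
  have hpos : 0 < h := sibuyaLimit_pos hα ht
  have hFlim : Tendsto (fun p : ℕ × ℕ => p.1 * sibuyaSum α p.1 p.2 *
      (t / ((p.2 : ℝ) / (p.1 : ℝ) ^ α))) (ratioFilter α t) (𝓝 h) := by
    have h1 : Tendsto (fun p : ℕ × ℕ => (p.2 : ℝ) / (p.1 : ℝ) ^ α) (ratioFilter α t) (𝓝 t) :=
      tendsto_comap.mono_left inf_le_right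
    have h2 := (tendsto_mul_sibuyaSum_ratioFilter hα t).mul
      ((tendsto_const_nhds (x := t)).div h1 ht.ne')
    rwa [div_self ht.ne', mul_one] at h2
  refine Metric.tendsto_nhds.2 fun e he => ?_
  obtain ⟨ε, hε, hεh, hεe⟩ : ∃ ε > 0, ε < h ∧ 3 * ε / h + ε < e := by
    have hlim : Tendsto (fun ε : ℝ => 3 * ε / h + ε) (𝓝[>] 0) (𝓝 0) := by
      have : Continuous fun ε : ℝ => 3 * ε / h + ε := by fun_prop
      simpa using (this.tendsto 0).mono_left nhdsWithin_le_nhds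
    obtain ⟨ε, h1, h2, h3⟩ := ((hlim.eventually_lt_const he).and
      (Ioo_mem_nhdsGT hpos)).exists
    exact ⟨ε, h2, h3, h1⟩
  obtain ⟨η, hη, n₀, hloc⟩ := exists_forall_abs_sub_lt_of_tendsto hFlim hε
  obtain ⟨σ, hσ0, hσ1, hση⟩ : ∃ σ > 0, σ < 1 ∧ σ * t < η := by
    refine ⟨min (1 / 2) (η / (2 * t)), by positivity,
      (min_le_left _ _).trans_lt (by norm_num), ?_⟩
    have h1 : min (1 / 2) (η / (2 * t)) * t ≤ η / (2 * t) * t :=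
      mul_le_mul_of_nonneg_right (min_le_right _ _) ht.le
    have h2 : η / (2 * t) * t = η / 2 := by field_simp
    linarith
  have hu : 0 < 1 + σ := by linarith
  have hv : 0 < 1 - σ := by linarith
  set cu := (1 + σ) - 1 - (1 + σ) * Real.log (1 + σ) with hcu
  set cv := (1 - σ) - 1 - (1 - σ) * Real.log (1 - σ) with hcv
  have hcu0 : cu < 0 := sub_one_sub_mul_log_neg hu (by linarith)
  have hcv0 : cv < 0 := sub_one_sub_mul_log_neg hv (by linarith)
  have htail : Tendsto (fun n : ℕ => (n : ℝ) * (t * (n : ℝ) ^ α) *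
      ((1 + σ) * Real.exp (t * (n : ℝ) ^ α * cu) + (1 - σ) * Real.exp (t * (n : ℝ) ^ α * cv)))
      atTop (𝓝 0) := by
    have h1 := ((tendsto_mul_exp_neg_zero h0 ht hcu0).const_mul (1 + σ)).add
      ((tendsto_mul_exp_neg_zero h0 ht hcv0).const_mul (1 - σ))
    simp only [mul_zero, add_zero] at h1
    exact h1.congr fun n => by ring
  have hz : Tendsto (fun n : ℕ => t * (n : ℝ) ^ α) atTop atTop :=
    ((tendsto_rpow_atTop h0).comp tendsto_natCast_atTop_atTop).const_mul_atTop ht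
  filter_upwards [eventually_gt_atTop 0, eventually_ge_atTop n₀, hz.eventually_ge_atTop 1,
    htail.eventually_lt_const hε] with n hn hn₀ hz1 hME
  have hn' : (1 : ℝ) ≤ n := by exact_mod_cast hn
  have hy : (0 : ℝ) < (n : ℝ) ^ α := by positivity
  set z := t * (n : ℝ) ^ α with hzdef
  have hz0 : 0 < z := by linarith
  set E := (1 + σ) * Real.exp (z * cu) + (1 - σ) * Real.exp (z * cv) with hEdef
  have hE0 : 0 ≤ E := by positivity
  let r : ℕ → ℝ := fun j =>
    n * sibuyaSum α n (j + 1) * (t / (((j + 1 : ℕ) : ℝ) / (n : ℝ) ^ α))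
  let τ : ℕ → ℝ := fun j =>
    (1 + σ) ^ ((j : ℝ) + 1 - (1 + σ) * z) + (1 - σ) ^ ((j : ℝ) + 1 - (1 - σ) * z)
  have hr : ∀ j, 0 ≤ r j := fun j =>
    mul_nonneg (mul_nonneg (by positivity) (sibuyaSum_nonneg hα _ _)) (by positivity)
  have hrM : ∀ j, r j ≤ n * z := fun j => by
    refine mul_le_mul (mul_le_of_le_one_right (by positivity) (sibuyaSum_le_one hα _ _)) ?_
      (by positivity) (by positivity)
    rw [div_div_eq_mul_div]
    exact div_le_self hz0.le (by push_cast; linarith [(Nat.cast_nonneg j : (0 : ℝ) ≤ j)])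
  have hEsum : HasSum (fun j => poissonWeight z j * τ j) E := by
    simp only [τ, mul_add]
    exact (hasSum_poissonWeight_mul_rpow z hu).add (hasSum_poissonWeight_mul_rpow z hv)
  have hbulk : ∀ j, τ j < 1 → |r j - h| < ε := by
    intro j hj
    have h1 : 0 < (1 + σ) ^ ((j : ℝ) + 1 - (1 + σ) * z) := by positivity
    have h2 : 0 < (1 - σ) ^ ((j : ℝ) + 1 - (1 - σ) * z) := by positivity
    have h3 : (j : ℝ) + 1 < (1 + σ) * z := by
      by_contra! hc
      have := Real.one_le_rpow (by linarith : (1 : ℝ) ≤ 1 + σ) (sub_nonneg.2 hc)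
      simp only [τ] at hj
      linarith
    have h4 : (1 - σ) * z < (j : ℝ) + 1 := by
      by_contra! hc
      have := Real.one_le_rpow_of_pos_of_le_one_of_nonpos hv (by linarith) (sub_nonpos.2 hc)
      simp only [τ] at hj
      linarith
    refine hloc n hn₀ (j + 1) (lt_of_lt_of_le ?_ hση.le)
    have h5 : ((j + 1 : ℕ) : ℝ) / (n : ℝ) ^ α - t = ((j : ℝ) + 1 - z) / (n : ℝ) ^ α := by
      rw [hzdef]; push_cast; field_simp
    have h6 : σ * t = σ * z / (n : ℝ) ^ α := by rw [hzdef]; field_simp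
    rw [h5, abs_div, abs_of_pos hy, h6]
    refine div_lt_div_of_pos_right ?_ hy
    rw [abs_lt]
    constructor <;> linarith
  set D := ∑ j ∈ Finset.range n, poissonWeight z j * r j with hDdef
  have hr0 : ∀ j, n ≤ j → r j = 0 := fun j hj => by
    simp [r, sibuyaSum_eq_zero_of_lt α (Nat.lt_succ_of_le hj)]
  have hD : HasSum (fun j => poissonWeight z j * r j) D :=
    hasSum_sum_of_ne_finset_zero fun j hj => by rw [hr0 j (by simpa using hj), mul_zero]
  have hD0 : 0 < D := by
    refine Finset.sum_pos' (fun j _ => mul_nonneg (poissonWeight_nonneg hz0.le j) (hr j))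
      ⟨0, Finset.mem_range.2 hn, ?_⟩
    obtain ⟨m, rfl⟩ := Nat.exists_eq_succ_of_ne_zero hn.ne'
    have h1 := sibuyaSum_one_succ_pos hα m
    simp only [r, poissonWeight]
    rw [zero_add, Nat.succ_eq_add_one]
    positivity
  have hden : ∑ j ∈ Finset.Icc 1 n, genFact n j α * z ^ j =
      n.factorial * Real.exp z / n * D := by
    rw [hDdef, Finset.mul_sum, ← Finset.Ico_add_one_right_eq_Icc, Finset.sum_Ico_eq_sum_range]
    refine Finset.sum_congr rfl fun j _ => ?_
    rw [add_comm 1 j]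
    exact genFact_mul_pow_eq hn j
  have htv := tsum_abs_sub_le_of_density_near_const (poissonWeight_nonneg hz0.le)
    (hasSum_poissonWeight z) hr hrM (fun j => by positivity) hEsum hD hD0 hbulk hε hεh hME.le
  have hEε : E ≤ ε := by
    have : 1 * E ≤ n * z * E := mul_le_mul_of_nonneg_right (by nlinarith) hE0
    linarith
  rw [Real.dist_eq, sub_zero, abs_of_nonneg
    (mul_nonneg (by norm_num) (tsum_nonneg fun _ => abs_nonneg _))]
  refine lt_of_le_of_lt (le_of_eq_of_le ?_ htv) (by linarith)
  congr 1
  rw [← Nat.succ_injective.tsum_eq]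
  · refine tsum_congr fun j => ?_
    rw [Nat.succ_eq_add_one, hden, if_pos (Nat.le_add_left 1 j), Nat.add_sub_cancel]
    congr 2
    have hc : (n.factorial * Real.exp z / n : ℝ) ≠ 0 := by positivity
    split_ifs with hj
    · rw [genFact_mul_pow_eq hn j, mul_div_mul_left _ _ hc]
    · rw [hr0 j (by omega)]
      simp
  · intro k hk
    cases k with
    | zero => simp at hk
    | succ j => exact ⟨j, rfl⟩
end

section
/- Let σ > 0 and ζ > 0, and for each integer n ≥ 1 let X̃_n be the ℕ-valued random variable with distribution Pr[X̃_n = m] = e^{-ζ} ζ^m Γ(mσ + n) / (m! Γ(mσ) B_n(ζ)) for m ≥ 1, where B_n(ζ) := ∑_{j=1}^{∞} e^{-ζ} (ζ^j/j!) Γ(σj+n)/Γ(σj). Set γ := σ/(1+σ) and c := (σζ)^{1/(1+σ)}/σ. Then X̃_n / n^{γ} converges in probability (equivalently, weakly) to the constant c: for every ε > 0, lim_{n→∞} ∑_{m ≥ 1 : |m·n^{-γ} - c| > ε} Pr[X̃_n = m] = 0. -/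
open Finset Filter Real MeasureTheory Topology Set

theorem Gamma_add_nat_eq_ascFact_mul {x : ℝ} (hx : 0 < x) (n : ℕ) :
    Real.Gamma (x + n) = ascFact x n * Real.Gamma x := by
  induction n with
  | zero => simp [ascFact]
  | succ n ih =>
    have h : x + (n : ℝ) ≠ 0 := by positivity
    rw [Nat.cast_succ, ← add_assoc, Real.Gamma_add_one h, ih, ascFact, ascFact,
      Finset.prod_range_succ]
    ring

theorem ascFact_nonneg {x : ℝ} (hx : 0 ≤ x) (n : ℕ) : 0 ≤ ascFact x n :=
  Finset.prod_nonneg fun _ _ => by positivity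

theorem ascFact_zero_left {n : ℕ} (hn : n ≠ 0) : ascFact 0 n = 0 :=
  Finset.prod_eq_zero (Finset.mem_range.2 (Nat.pos_of_ne_zero hn)) (by simp)

theorem mul_rpow_le_add {σ y : ℝ} (hσ : 0 < σ) (hy : 0 < y) :
    y * ((y + σ + 1) / (y + σ)) ^ σ ≤ y + σ := by
  have hs : 0 < y + σ := by positivity
  have h1 : ((y + σ + 1) / (y + σ)) ^ σ ≤ Real.exp (σ / (y + σ)) := by
    rw [show σ / (y + σ) = 1 / (y + σ) * σ by ring, Real.exp_mul]
    refine Real.rpow_le_rpow (by positivity) ?_ hσ.le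
    rw [show (y + σ + 1) / (y + σ) = 1 / (y + σ) + 1 by field_simp; ring]
    exact Real.add_one_le_exp _
  have h2 : y ≤ (y + σ) * Real.exp (-(σ / (y + σ))) := by
    have h3 := Real.add_one_le_exp (-(σ / (y + σ)))
    calc y = (y + σ) * (-(σ / (y + σ)) + 1) := by field_simp; ring
      _ ≤ _ := by gcongr
  calc y * ((y + σ + 1) / (y + σ)) ^ σ
      ≤ ((y + σ) * Real.exp (-(σ / (y + σ)))) * Real.exp (σ / (y + σ)) := by gcongr
    _ = y + σ := by rw [mul_assoc, ← Real.exp_add]; simp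

theorem add_le_mul_rpow {σ y : ℝ} (hσ : 0 < σ) (hy : 1 < y) :
    y + σ ≤ y * (y / (y - 1)) ^ σ := by
  have hy0 : 0 < y := by linarith
  have hy1 : 0 < y - 1 := by linarith
  have h1 : Real.exp (1 / y) ≤ y / (y - 1) := by
    have h := Real.add_one_le_exp (-(1 / y))
    rw [Real.exp_neg] at h
    have h2 : -(1 / y) + 1 = (y / (y - 1))⁻¹ := by field_simp; ring
    rw [h2] at h
    exact (inv_le_inv₀ (by positivity) (Real.exp_pos _)).1 h
  have h2 : σ / y + 1 ≤ (y / (y - 1)) ^ σ :=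
    calc σ / y + 1 ≤ Real.exp (σ / y) := Real.add_one_le_exp _
      _ = Real.exp (1 / y) ^ σ := by rw [← Real.exp_mul]; congr 1; ring
      _ ≤ _ := Real.rpow_le_rpow (Real.exp_pos _).le h1 hσ.le
  calc y + σ = y * (σ / y + 1) := by field_simp; ring
    _ ≤ _ := by gcongr

theorem ascFact_mul_rpow_le {σ x : ℝ} (hσ : 0 < σ) (hx : 0 < x) (n : ℕ) :
    ascFact x n * ((x + σ + n) / (x + σ)) ^ σ ≤ ascFact (x + σ) n := by
  induction n with
  | zero => simp [ascFact, div_self (by positivity : x + σ ≠ 0)]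
  | succ n ih =>
    have h := mul_rpow_le_add hσ (y := x + n) (by positivity)
    have hsplit : ((x + σ + (n + 1 : ℕ)) / (x + σ)) ^ σ
        = ((x + σ + n) / (x + σ)) ^ σ * ((x + n + σ + 1) / (x + n + σ)) ^ σ := by
      rw [← Real.mul_rpow (by positivity) (by positivity)]
      congr 1
      push_cast
      have : x + σ + n ≠ 0 := by positivity
      have : x + n + σ ≠ 0 := by positivity
      field_simp
      ring
    have h0 := ascFact_nonneg hx.le n
    have h0' := ascFact_nonneg (add_pos hx hσ).le n
    calc ascFact x (n + 1) * ((x + σ + (n + 1 : ℕ)) / (x + σ)) ^ σ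
        = (ascFact x n * ((x + σ + n) / (x + σ)) ^ σ) *
            ((x + n) * ((x + n + σ + 1) / (x + n + σ)) ^ σ) := by
          rw [hsplit, ascFact, ascFact, Finset.prod_range_succ]; ring
      _ ≤ ascFact (x + σ) n * (x + n + σ) := by gcongr
      _ = ascFact (x + σ) (n + 1) := by
          rw [ascFact, ascFact, Finset.prod_range_succ]; ring

theorem ascFact_add_le {σ x : ℝ} (hσ : 0 < σ) (hx : 1 < x) (n : ℕ) :
    ascFact (x + σ) n ≤ ascFact x n * ((x - 1 + n) / (x - 1)) ^ σ := by
  have hx1 : 0 < x - 1 := by linarith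
  have hx0 : 0 < x := by linarith
  induction n with
  | zero => simp [ascFact, div_self hx1.ne']
  | succ n ih =>
    have hn : (0 : ℝ) ≤ n := by positivity
    have hxn : 0 < x + n - 1 := by linarith
    have h := add_le_mul_rpow hσ (y := x + n) (by linarith)
    have hsplit : ((x - 1 + (n + 1 : ℕ)) / (x - 1)) ^ σ
        = ((x - 1 + n) / (x - 1)) ^ σ * ((x + n) / (x + n - 1)) ^ σ := by
      rw [← Real.mul_rpow (by positivity) (by positivity)]
      congr 1
      push_cast
      have : x - 1 + n ≠ 0 := by positivity
      field_simp
      ring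
    have h0 := ascFact_nonneg hx0.le n
    calc ascFact (x + σ) (n + 1) = ascFact (x + σ) n * (x + n + σ) := by
          rw [ascFact, ascFact, Finset.prod_range_succ]; ring
      _ ≤ (ascFact x n * ((x - 1 + n) / (x - 1)) ^ σ) *
            ((x + n) * ((x + n) / (x + n - 1)) ^ σ) := by gcongr
      _ = _ := by
          rw [hsplit, ascFact, ascFact, Finset.prod_range_succ]; ring

theorem tsum_ite_le_of_ratio {p : ℕ → ℝ} (hp : ∀ m, 0 ≤ p m) (hs : Summable p)
    (h1 : ∑' m, p m ≤ 1) (P : ℕ → Prop) [DecidablePred P] (K : ℕ) {ρ a b : ℝ}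
    (hρ : 0 ≤ ρ) (ha : 0 ≤ a) (hup : ∀ m : ℕ, a ≤ m → p (m + 1) ≤ ρ * p m)
    (hlow : ∀ m : ℕ, (m : ℝ) + 1 ≤ b → p m ≤ ρ * p (m + 1))
    (hP : ∀ m : ℕ, P m → a + K ≤ m ∨ (m : ℝ) + K ≤ b) :
    ∑' m, (if P m then p m else 0) ≤ 2 * ρ ^ K := by
  have hup' : ∀ (k m : ℕ), a ≤ m → p (m + k) ≤ ρ ^ k * p m := by
    intro k m hm
    induction k with
    | zero => simp
    | succ k ih =>
      calc p (m + k + 1) ≤ ρ * p (m + k) := hup _ (by push_cast; linarith [k.cast_nonneg (α := ℝ)])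
        _ ≤ ρ * (ρ ^ k * p m) := by gcongr
        _ = _ := by ring
  have hlow' : ∀ (k m : ℕ), (m : ℝ) + k ≤ b → p m ≤ ρ ^ k * p (m + k) := by
    intro k m
    induction k with
    | zero => simp
    | succ k ih =>
      intro hm
      push_cast at hm
      calc p m ≤ ρ ^ k * p (m + k) := ih (by linarith)
        _ ≤ ρ ^ k * (ρ * p (m + k + 1)) := by
          gcongr
          exact hlow _ (by push_cast; linarith)
        _ = _ := by rw [← add_assoc]; ring
  set g : ℕ → ℝ := fun m => if K ≤ m then p (m - K) else 0 with hg
  have hgK : (fun m => g (m + K)) = p := by ext m; simp [hg]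
  have hgs : Summable g := (summable_nat_add_iff K).1 (by rw [hgK]; exact hs)
  have hg0 : ∀ m, 0 ≤ g m := fun m => by
    simp only [hg]; split_ifs <;> simp [hp]
  have hgsum : ∑' m, g m = ∑' m, p m := by
    rw [← hgs.sum_add_tsum_nat_add K, hgK, Finset.sum_eq_zero, zero_add]
    intro m hm
    simp [hg, Finset.mem_range.1 hm]
  have hsK : Summable fun m => p (m + K) := (summable_nat_add_iff K).2 hs
  have hsum : ∑' m, p (m + K) ≤ ∑' m, p m := by
    rw [← hs.sum_add_tsum_nat_add K]
    linarith [Finset.sum_nonneg (s := Finset.range K) fun i _ => hp i]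
  have hbd : ∀ m, (if P m then p m else 0) ≤ ρ ^ K * (g m + p (m + K)) := by
    intro m
    have h0 : 0 ≤ ρ ^ K := by positivity
    have := mul_nonneg h0 (hg0 m)
    have := mul_nonneg h0 (hp (m + K))
    split_ifs with h
    · rcases hP m h with h | h
      · have hKm : K ≤ m := by
          have : (K : ℝ) ≤ m := by linarith
          exact_mod_cast this
        have h2 := hup' K (m - K) (by push_cast [hKm]; linarith)
        rw [Nat.sub_add_cancel hKm] at h2
        have : g m = p (m - K) := by simp [hg, hKm]
        rw [this, mul_add]; linarith
      · rw [mul_add]; linarith [hlow' K m h]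
    · rw [mul_add]; linarith
  have hS : Summable fun m => ρ ^ K * (g m + p (m + K)) := (hgs.add hsK).mul_left _
  calc ∑' m, (if P m then p m else 0) ≤ ∑' m, ρ ^ K * (g m + p (m + K)) := by
        refine Summable.tsum_le_tsum hbd (Summable.of_nonneg_of_le ?_ hbd hS) hS
        intro m; split_ifs <;> simp [hp]
    _ = ρ ^ K * (∑' m, g m + ∑' m, p (m + K)) := by
        rw [tsum_mul_left, hgs.tsum_add hsK]
    _ ≤ ρ ^ K * (1 + 1) := by gcongr <;> linarith
    _ = _ := by ring

/-- The leading-order ratio of consecutive weights at `m = s n^{σ/(1+σ)}`. -/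
theorem leading_ratio_eq {σ ζ s N : ℝ} (hσ : 0 < σ) (hζ : 0 < ζ) (hs : 0 < s) (hN : 0 < N) :
    ζ / (s * N ^ (σ / (1 + σ))) * (N / (s * N ^ (σ / (1 + σ)) * σ)) ^ σ
      = ((σ * ζ) ^ ((1 : ℝ) / (1 + σ)) / σ / s) ^ (1 + σ) := by
  have h1 : 0 < 1 + σ := by positivity
  have hM : (N ^ (σ / (1 + σ))) * (N ^ (σ / (1 + σ))) ^ σ = N ^ σ := by
    rw [← Real.rpow_one_add' (by positivity) h1.ne', ← Real.rpow_mul hN.le,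
      div_mul_cancel₀ _ h1.ne']
  have hM0 : 0 < N ^ (σ / (1 + σ)) := by positivity
  rw [Real.div_rpow (by positivity) hs.le, Real.div_rpow (by positivity) hσ.le,
    ← Real.rpow_mul (by positivity), one_div_mul_cancel h1.ne', Real.rpow_one,
    Real.div_rpow hN.le (by positivity), Real.mul_rpow (by positivity) hσ.le,
    Real.mul_rpow hs.le hM0.le, ← hM, Real.rpow_one_add' hs.le h1.ne',
    Real.rpow_one_add' hσ.le h1.ne']
  have := (Real.rpow_pos_of_pos hM0 σ).ne'
  field_simp

theorem tendsto_ratio_bound {σ ζ t : ℝ} (hσ : 0 < σ) (hζ : 0 < ζ) (ht : 0 < t) :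
    Tendsto (fun n : ℕ => ζ / (t * (n : ℝ) ^ (σ / (1 + σ))) *
        (1 + n / (t * (n : ℝ) ^ (σ / (1 + σ)) * σ - 1)) ^ σ) atTop
      (𝓝 (((σ * ζ) ^ ((1 : ℝ) / (1 + σ)) / σ / t) ^ (1 + σ))) := by
  have h1 : 0 < 1 + σ := by positivity
  have hMtop : Tendsto (fun n : ℕ => (n : ℝ) ^ (σ / (1 + σ))) atTop atTop :=
    (tendsto_rpow_atTop (by positivity)).comp tendsto_natCast_atTop_atTop
  have hA : Tendsto (fun n : ℕ => t * (n : ℝ) ^ (σ / (1 + σ)) * σ) atTop atTop :=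
    (hMtop.const_mul_atTop ht).atTop_mul_const hσ
  have hB : Tendsto (fun n : ℕ => (t * (n : ℝ) ^ (σ / (1 + σ)) * σ - 1)⁻¹) atTop (𝓝 0) :=
    tendsto_inv_atTop_zero.comp (tendsto_atTop_add_const_right _ (-1) hA)
  have hC : Tendsto (fun n : ℕ => t * σ * (n : ℝ) ^ (-(1 / (1 + σ)))) atTop (𝓝 0) := by
    simpa using ((tendsto_rpow_neg_atTop (by positivity : 0 < 1 / (1 + σ))).comp
      tendsto_natCast_atTop_atTop).const_mul (t * σ)
  have hD : Tendsto (fun n : ℕ => (t * σ * (n : ℝ) ^ (-(1 / (1 + σ))) +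
      (1 + (t * (n : ℝ) ^ (σ / (1 + σ)) * σ - 1)⁻¹)) ^ σ) atTop (𝓝 1) := by
    simpa using (hC.add (hB.const_add 1)).rpow_const (p := σ) (Or.inr hσ.le)
  have hE := hD.const_mul (((σ * ζ) ^ ((1 : ℝ) / (1 + σ)) / σ / t) ^ (1 + σ))
  rw [mul_one] at hE
  refine hE.congr' ?_
  filter_upwards [eventually_gt_atTop 0, hA.eventually_gt_atTop 1] with n hn hAn
  have hn0 : (0 : ℝ) < n := by exact_mod_cast hn
  have hpos : 0 < t * (n : ℝ) ^ (σ / (1 + σ)) * σ - 1 := by linarith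
  have hneg : (n : ℝ) ^ (-(1 / (1 + σ))) = (n : ℝ) ^ (σ / (1 + σ)) / n := by
    rw [← Real.rpow_sub_one hn0.ne']
    congr 1
    field_simp
    ring
  rw [← leading_ratio_eq hσ hζ ht hn0, hneg, mul_assoc,
    ← Real.mul_rpow (by positivity) (by positivity)]
  congr 2
  have : 0 < (n : ℝ) ^ (σ / (1 + σ)) := by positivity
  generalize (n : ℝ) ^ (σ / (1 + σ)) = M at *
  have := hpos.ne'
  field_simp
  ring

/-- for `σ, ζ > 0`, the tilted Poisson random variable `X̃_n` with
`Pr[X̃_n = m] = e^{-ζ} ζ^m Γ(mσ+n)/(m! Γ(mσ) B_n(ζ))`, where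
`B_n(ζ) = ∑_{j≥1} e^{-ζ}(ζ^j/j!) Γ(σj+n)/Γ(σj)`, satisfies
`X̃_n / n^{σ/(1+σ)} → (σζ)^{1/(1+σ)}/σ` in probability. (The `m = 0` terms vanish since
`Γ(0) = 0` in Mathlib's convention, so sums over all `m : ℕ` coincide with sums over `m ≥ 1`.) -/
theorem tilted_poisson_tendsto_const
    (σ ζ : ℝ) (hσ : 0 < σ) (hζ : 0 < ζ) (ε : ℝ) (hε : 0 < ε) :
    Tendsto (fun n : ℕ =>
        ∑' m : ℕ,
          if ε < |(m : ℝ) * (n : ℝ) ^ (-(σ / (1 + σ))) - (σ * ζ) ^ ((1 : ℝ) / (1 + σ)) / σ| then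
            Real.exp (-ζ) * ζ ^ m * Real.Gamma ((m : ℝ) * σ + n) /
              ((Nat.factorial m : ℝ) * Real.Gamma ((m : ℝ) * σ) *
                ∑' j : ℕ, Real.exp (-ζ) * (ζ ^ j / (Nat.factorial j : ℝ)) *
                  (Real.Gamma (σ * j + n) / Real.Gamma (σ * j)))
          else 0)
      atTop (𝓝 0) := by
  set c : ℝ := (σ * ζ) ^ ((1 : ℝ) / (1 + σ)) / σ with hc
  have hc0 : 0 < c := by positivity
  have h1σ : 0 < 1 + σ := by positivity
  set t : ℝ := c + ε / 2 with ht
  set u : ℝ := max (c - ε / 2) (c / 2) with hu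
  have ht0 : 0 < t := by positivity
  have hu0 : 0 < u := lt_max_of_lt_right (by positivity)
  have huc : u < c := max_lt (by linarith) (by linarith)
  have hct : (c / t) ^ (1 + σ) < 1 :=
    Real.rpow_lt_one (by positivity) ((div_lt_one ht0).2 (by linarith)) h1σ
  have hcu : (u / c) ^ (1 + σ) < 1 :=
    Real.rpow_lt_one (by positivity) ((div_lt_one hc0).2 huc) h1σ
  obtain ⟨ρ, hρ, hρ1⟩ := exists_between (max_lt hct hcu)
  obtain ⟨hρt, hρu⟩ := max_lt_iff.1 hρ
  have hρ0 : 0 < ρ := lt_of_le_of_lt (by positivity) hρt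
  have hMtop : Tendsto (fun n : ℕ => (n : ℝ) ^ (σ / (1 + σ))) atTop atTop :=
    (tendsto_rpow_atTop (by positivity)).comp tendsto_natCast_atTop_atTop
  have hnonneg : ∀ n m : ℕ, 0 ≤ Real.exp (-ζ) * ζ ^ m * Real.Gamma ((m : ℝ) * σ + n) /
      ((Nat.factorial m : ℝ) * Real.Gamma ((m : ℝ) * σ)) := fun n m => by
    have := Real.Gamma_nonneg_of_nonneg (by positivity : 0 ≤ (m : ℝ) * σ + n)
    have := Real.Gamma_nonneg_of_nonneg (by positivity : 0 ≤ (m : ℝ) * σ)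
    positivity
  have key : ∀ K : ℕ, ∀ᶠ n : ℕ in atTop, (∑' m : ℕ,
          if ε < |(m : ℝ) * (n : ℝ) ^ (-(σ / (1 + σ))) - c| then
            Real.exp (-ζ) * ζ ^ m * Real.Gamma ((m : ℝ) * σ + n) /
              ((Nat.factorial m : ℝ) * Real.Gamma ((m : ℝ) * σ) *
                ∑' j : ℕ, Real.exp (-ζ) * (ζ ^ j / (Nat.factorial j : ℝ)) *
                  (Real.Gamma (σ * j + n) / Real.Gamma (σ * j)))
          else 0) ≤ 2 * ρ ^ K := by
    intro K
    filter_upwards [eventually_gt_atTop 0,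
      (tendsto_ratio_bound hσ hζ ht0).eventually (eventually_lt_nhds hρt),
      ((hMtop.const_mul_atTop ht0).atTop_mul_const hσ).eventually_gt_atTop 1,
      hMtop.eventually_ge_atTop (K / (ε / 2))] with n hn hratio hA hMK
    set M : ℝ := (n : ℝ) ^ (σ / (1 + σ)) with hM
    have hn0 : (0 : ℝ) < n := by exact_mod_cast hn
    have hM0 : 0 < M := by positivity
    have hKM : (K : ℝ) ≤ ε / 2 * M := by
      rw [div_le_iff₀ (by positivity)] at hMK; linarith
    set v : ℕ → ℝ := fun m => Real.exp (-ζ) * ζ ^ m * Real.Gamma ((m : ℝ) * σ + n) /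
      ((Nat.factorial m : ℝ) * Real.Gamma ((m : ℝ) * σ)) with hv
    have hv0 : ∀ m, 0 ≤ v m := hnonneg n
    have hva : ∀ m : ℕ, v m = Real.exp (-ζ) * ζ ^ m / (Nat.factorial m : ℝ) *
        ascFact (m * σ) n := by
      intro m
      rcases Nat.eq_zero_or_pos m with rfl | hm
      · simp [hv, ascFact_zero_left hn.ne', Real.Gamma_zero]
      · have hx : 0 < (m : ℝ) * σ := by positivity
        have := (Real.Gamma_pos_of_pos hx).ne'
        simp only [hv]
        rw [Gamma_add_nat_eq_ascFact_mul hx]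
        field_simp
    have hvs : ∀ m : ℕ, v (m + 1) = Real.exp (-ζ) * ζ ^ m / (Nat.factorial m : ℝ) *
        (ζ / (m + 1)) * ascFact (m * σ + σ) n := by
      intro m
      rw [hva, Nat.factorial_succ, pow_succ]
      push_cast
      rw [show ((m : ℝ) + 1) * σ = m * σ + σ by ring]
      field_simp
    have hup : ∀ m : ℕ, t * M ≤ m → v (m + 1) ≤ ρ * v m := by
      intro m hm
      have hmσ : t * M * σ ≤ m * σ := by gcongr
      have hpos : 0 < t * M * σ - 1 := by linarith
      have hpos' : 0 < (m : ℝ) * σ - 1 := by linarith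
      have hb : ζ / (m + 1) * (((m : ℝ) * σ - 1 + n) / (m * σ - 1)) ^ σ ≤ ρ := by
        refine le_trans ?_ hratio.le
        rw [add_div, div_self hpos'.ne']
        gcongr
        linarith
      have h0 := ascFact_nonneg (by positivity : 0 ≤ (m : ℝ) * σ) n
      have h := ascFact_add_le hσ (x := m * σ) (by linarith) n
      calc v (m + 1) ≤ Real.exp (-ζ) * ζ ^ m / (Nat.factorial m : ℝ) * (ζ / (m + 1)) *
            (ascFact (m * σ) n * ((m * σ - 1 + n) / (m * σ - 1)) ^ σ) := by
            rw [hvs]; gcongr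
        _ = (ζ / (m + 1) * (((m : ℝ) * σ - 1 + n) / (m * σ - 1)) ^ σ) * v m := by
            rw [hva]; ring
        _ ≤ ρ * v m := mul_le_mul_of_nonneg_right hb (hv0 m)
    have hlow : ∀ m : ℕ, (m : ℝ) + 1 ≤ u * M → v m ≤ ρ * v (m + 1) := by
      intro m hm
      rcases Nat.eq_zero_or_pos m with rfl | hm0
      · rw [hva 0]
        simpa [ascFact_zero_left hn.ne'] using mul_nonneg hρ0.le (hv0 1)
      have hx : 0 < (m : ℝ) * σ := by positivity
      have hb : (c / u) ^ (1 + σ) ≤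
          ζ / (m + 1) * (((m : ℝ) * σ + σ + n) / (m * σ + σ)) ^ σ := by
        rw [hc, ← leading_ratio_eq hσ hζ hu0 hn0]
        gcongr
        · linarith
        · rw [← hM]; nlinarith
      have h := ascFact_mul_rpow_le hσ hx n
      have h2 : (c / u) ^ (1 + σ) * v m ≤ v (m + 1) :=
        calc (c / u) ^ (1 + σ) * v m
            ≤ (ζ / (m + 1) * (((m : ℝ) * σ + σ + n) / (m * σ + σ)) ^ σ) * v m :=
              mul_le_mul_of_nonneg_right hb (hv0 m)
          _ = Real.exp (-ζ) * ζ ^ m / (Nat.factorial m : ℝ) * (ζ / (m + 1)) *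
              (ascFact (m * σ) n * ((m * σ + σ + n) / (m * σ + σ)) ^ σ) := by
              rw [hva]; ring
          _ ≤ v (m + 1) := by rw [hvs]; gcongr
      calc v m = (u / c) ^ (1 + σ) * ((c / u) ^ (1 + σ) * v m) := by
            rw [← mul_assoc, ← Real.mul_rpow (by positivity) (by positivity),
              div_mul_div_cancel₀ hc0.ne', div_self hu0.ne', Real.one_rpow, one_mul]
        _ ≤ ρ * v (m + 1) := by
            have := hv0 (m + 1)
            have := hv0 m
            gcongr
    have hsum : Summable v := by
      refine summable_of_ratio_norm_eventually_le hρ1 ?_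
      filter_upwards [tendsto_natCast_atTop_atTop.eventually_ge_atTop (t * M)] with m hm
      simpa [abs_of_nonneg (hv0 _)] using hup m hm
    set B : ℝ := ∑' j : ℕ, Real.exp (-ζ) * (ζ ^ j / (Nat.factorial j : ℝ)) *
      (Real.Gamma (σ * j + n) / Real.Gamma (σ * j)) with hB
    have hvB : ∑' m, v m = B := by
      refine tsum_congr fun m => ?_
      simp only [hv]
      rw [mul_comm σ]
      ring
    have hB0 : 0 ≤ B := hvB ▸ tsum_nonneg hv0
    have hmain := tsum_ite_le_of_ratio (p := fun m => v m / B) (ρ := ρ) (a := t * M) (b := u * M)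
      (fun m => div_nonneg (hv0 m) hB0) (hsum.div_const B)
      (by rw [tsum_div_const, hvB]; exact div_self_le_one B)
      (fun m : ℕ => ε < |(m : ℝ) * (n : ℝ) ^ (-(σ / (1 + σ))) - c|) K hρ0.le (by positivity)
      (fun m hm => by
        rw [← mul_div_assoc]; exact div_le_div_of_nonneg_right (hup m hm) hB0)
      (fun m hm => by
        rw [← mul_div_assoc]; exact div_le_div_of_nonneg_right (hlow m hm) hB0)
      (by
        intro m hm
        rw [Real.rpow_neg hn0.le, ← hM, ← div_eq_mul_inv] at hm
        rcases lt_abs.1 hm with h | h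
        · left
          have : c + ε < m / M := by linarith
          rw [lt_div_iff₀ hM0] at this
          rw [ht]; linarith
        · right
          have : (m : ℝ) / M < c - ε := by linarith
          rw [div_lt_iff₀ hM0] at this
          have : (c - ε / 2) * M ≤ u * M := by
            gcongr
            exact le_max_left _ _
          linarith)
    simpa only [hv, div_div] using hmain
  refine tendsto_order.2 ⟨fun a ha => Eventually.of_forall fun n => ha.trans_le ?_, fun a ha => ?_⟩
  · refine tsum_nonneg fun m => ?_
    split_ifs
    · rw [← div_div]
      refine div_nonneg (hnonneg n m) (tsum_nonneg fun j => ?_)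
      have := Real.Gamma_nonneg_of_nonneg (by positivity : 0 ≤ σ * (j : ℝ) + n)
      have := Real.Gamma_nonneg_of_nonneg (by positivity : 0 ≤ σ * (j : ℝ))
      positivity
    · exact le_rfl
  · obtain ⟨K, hK⟩ := exists_pow_lt_of_lt_one (half_pos ha) hρ1
    filter_upwards [key K] with n hn
    linarith
end
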